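/- For every integer n ≥ 1, the centralizer of B_n in the endomorphism algebra of W_n, i.e. the K-subalgebra {A ∈ Module.End K W_n : A ∘ B_n = B_n ∘ A}, has K-dimension (2n choose n). -/

import Mathlib

set_option synthInstance.maxHeartbeats 1000000
set_option maxHeartbeats 1000000

noncomputable section

/-- The ground field `K = ℂ(q)`, the complex rational functions. -/
abbrev K : Type := RatFunc ℂ

/-- The variable `q ∈ K = ℂ(q)`. -/
noncomputable def q : K := RatFunc.X

/-- The quantum integer `[m] = (q^m - q^{-m})/(q - q⁻¹) ∈ K`, for `m : ℤ`. -/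
noncomputable def qint (m : ℤ) : K := (q ^ m - q ^ (-m)) / (q - q⁻¹)

/-- `W n` is the `K`-vector space of functions `(Fin n → Bool) → K`, with standard basis
indexed by the words of length `n` in the letters `x` (encoded `false`) and `y` (encoded
`true`); it models the tensor power `V^{⊗n}` of the standard representation of
`U_q(gl₂)`. -/
abbrev W (n : ℕ) : Type := (Fin n → Bool) → K

/-- `ε(x) = -1`, `ε(y) = 1`. -/
def eps (b : Bool) : ℤ := if b then 1 else -1

/-- The word `w` with its `i`-th letter flipped. -/
def flipLetter (n : ℕ) (w : Fin n → Bool) (i : Fin n) : Fin n → Bool :=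
  Function.update w i (!(w i))

/-- The `K`-linear endomorphism `B` of `W n = V^{⊗n}` given on basis vectors by
`B e_w = Σ_{i=0}^{n-1} (Π_{j=i+1}^{n-1} q^{ε(w_j)}) e_{w⁽ⁱ⁾}`; it is the action on `V^{⊗n}`
of the generator `B = q⁻¹EK⁻¹ + F` of the coideal subalgebra `U_q'(gl₁ × gl₁)` of
`U_q(gl₂)`. -/
noncomputable def Bop (n : ℕ) : Module.End K (W n) where
  toFun f := fun u => ∑ i : Fin n,
    (∏ j ∈ Finset.univ.filter (fun j => i < j), q ^ eps (u j)) * f (flipLetter n u i)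
  map_add' f g := by
    funext u
    simp only [Pi.add_apply, mul_add]
    rw [Finset.sum_add_distrib]
  map_smul' c f := by
    funext u
    simp only [Pi.smul_apply, smul_eq_mul, RingHom.id_apply]
    rw [Finset.mul_sum]
    exact Finset.sum_congr rfl fun i _ => by ring

theorem q_ne_zero : q ≠ 0 := RatFunc.X_ne_zero

theorem q_pow_eq_one {n : ℕ} (h : q ^ n = 1) : n = 0 := by
  have h' : algebraMap (Polynomial ℂ) K (Polynomial.X ^ n) = algebraMap (Polynomial ℂ) K 1 := by
    rw [map_pow, RatFunc.algebraMap_X, map_one]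
    exact h
  have := congrArg Polynomial.natDegree (RatFunc.algebraMap_injective ℂ h')
  simpa using this

theorem q_zpow_eq_one {m : ℤ} (h : q ^ m = 1) : m = 0 := by
  obtain ⟨n, rfl | rfl⟩ := m.eq_nat_or_neg
  · rw [zpow_natCast] at h
    simp [q_pow_eq_one h]
  · rw [zpow_neg, zpow_natCast, inv_eq_one] at h
    simp [q_pow_eq_one h]

theorem q_zpow_ne_neg_one (m : ℤ) : q ^ m ≠ -1 := by
  intro h
  have h2 : q ^ (2 * m) = 1 := by
    rw [two_mul, zpow_add₀ q_ne_zero, h]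
    ring
  have hm : m = 0 := by
    have := q_zpow_eq_one h2
    omega
  rw [hm, zpow_zero] at h
  have : (2 : K) = 0 := by linear_combination h
  exact two_ne_zero this

theorem q_zpow_add_zpow_neg_ne_zero (m : ℤ) : q ^ m + q ^ (-m) ≠ 0 := by
  intro h
  apply q_zpow_ne_neg_one (2 * m)
  have hm : q ^ m * q ^ (-m) = 1 := by
    rw [← zpow_add₀ q_ne_zero, add_neg_cancel, zpow_zero]
  rw [two_mul, zpow_add₀ q_ne_zero]
  linear_combination q ^ m * h - hm

theorem q_sub_inv_ne_zero : q - q⁻¹ ≠ 0 := by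
  intro h
  have h2 : q ^ (2 : ℤ) = 1 := by
    have hq : q * q⁻¹ = 1 := mul_inv_cancel₀ q_ne_zero
    rw [zpow_two]
    linear_combination q * h + hq
  simpa using q_zpow_eq_one h2

theorem qint_injective : Function.Injective qint := by
  intro m k h
  rw [qint, qint, div_left_inj' q_sub_inv_ne_zero] at h
  have hm : q ^ m * q ^ (-m) = 1 := by
    rw [← zpow_add₀ q_ne_zero, add_neg_cancel, zpow_zero]
  have hk : q ^ k * q ^ (-k) = 1 := by
    rw [← zpow_add₀ q_ne_zero, add_neg_cancel, zpow_zero]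
  have hprod : (q ^ m - q ^ k) * (1 + q ^ (-m) * q ^ (-k)) = 0 := by
    linear_combination h + q ^ (-k) * hm - q ^ (-m) * hk
  rcases mul_eq_zero.1 hprod with h1 | h1
  · have : q ^ (m - k) = 1 := by
      rw [zpow_sub₀ q_ne_zero, div_eq_one_iff_eq (zpow_ne_zero _ q_ne_zero)]
      exact sub_eq_zero.1 h1
    have := q_zpow_eq_one this
    omega
  · rw [← zpow_add₀ q_ne_zero] at h1
    exact absurd (by linear_combination h1) (q_zpow_ne_neg_one (-m + -k))

/-- The sum of the signs of the letters of a word. -/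
def weight {n : ℕ} (s : Fin n → Bool) : ℤ := ∑ j, eps (s j)

/-- The coefficient at the letter `c` of the eigenvector of sign `a` of the matrix
`!![[m] q⁻¹, 1; 1, [m] q]`, whose eigenvalues are `[m + 1]` and `[m - 1]`. -/
def letterCoeff (m : ℤ) (a c : Bool) : K :=
  if c then eps a * q ^ (eps a * m) else 1

/-- Eigenvectors of `Bop n` indexed by words, built by appending one letter at a time. -/
def eigenvector : (n : ℕ) → (Fin n → Bool) → W n
  | 0, _ => fun _ => 1
  | n + 1, s => fun u => eigenvector n (Fin.init s) (Fin.init u) *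
      letterCoeff (weight (Fin.init s)) (s (Fin.last n)) (u (Fin.last n))

theorem eigenvector_snoc {n : ℕ} (s : Fin n → Bool) (a : Bool) (u : Fin n → Bool) (c : Bool) :
    eigenvector (n + 1) (Fin.snoc s a : Fin (n + 1) → Bool) (Fin.snoc u c : Fin (n + 1) → Bool) =
      eigenvector n s u * letterCoeff (weight s) a c := by
  simp [eigenvector]

theorem weight_snoc {n : ℕ} (s : Fin n → Bool) (a : Bool) :
    weight (Fin.snoc s a : Fin (n + 1) → Bool) = weight s + eps a := by
  simp [weight, Fin.sum_univ_castSucc]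

theorem letterCoeff_eigen (m : ℤ) (a c : Bool) :
    q ^ eps c * qint m * letterCoeff m a c + letterCoeff m a (!c) =
      qint (m + eps a) * letterCoeff m a c := by
  have hd := q_sub_inv_ne_zero
  have hq := q_ne_zero
  have hm : q ^ m ≠ 0 := zpow_ne_zero _ q_ne_zero
  have hd' : q ^ 2 - 1 ≠ 0 := by
    intro h
    apply hd
    field_simp
    rw [h, mul_zero]
  cases a <;> cases c <;>
    simp [letterCoeff, eps, qint, zpow_add₀ q_ne_zero] <;>
    field_simp <;> ring

theorem flipLetter_snoc_castSucc {n : ℕ} (u : Fin n → Bool) (c : Bool) (i : Fin n) :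
    flipLetter (n + 1) (Fin.snoc u c : Fin (n + 1) → Bool) i.castSucc =
      (Fin.snoc (flipLetter n u i) c : Fin (n + 1) → Bool) := by
  simp [flipLetter, Fin.snoc_update]

theorem flipLetter_snoc_last {n : ℕ} (u : Fin n → Bool) (c : Bool) :
    flipLetter (n + 1) (Fin.snoc u c : Fin (n + 1) → Bool) (Fin.last n) =
      (Fin.snoc u (!c) : Fin (n + 1) → Bool) := by
  simp [flipLetter, Fin.update_snoc_last]

theorem Bop_apply (n : ℕ) (f : W n) (u : Fin n → Bool) :
    Bop n f u = ∑ i : Fin n,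
      (∏ j ∈ Finset.univ.filter (fun j => i < j), q ^ eps (u j)) * f (flipLetter n u i) := rfl

theorem Bop_snoc {n : ℕ} (f : W (n + 1)) (u : Fin n → Bool) (c : Bool) :
    Bop (n + 1) f (Fin.snoc u c : Fin (n + 1) → Bool) =
      q ^ eps c * Bop n (fun v => f (Fin.snoc v c : Fin (n + 1) → Bool)) u +
        f (Fin.snoc u (!c) : Fin (n + 1) → Bool) := by
  have hlast : ∀ j : Fin n, ¬ Fin.last n < j.castSucc := fun j => (Fin.castSucc_lt_last j).not_gt
  rw [Bop_apply, Bop_apply, Fin.sum_univ_castSucc, Finset.mul_sum]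
  simp only [flipLetter_snoc_castSucc, flipLetter_snoc_last, Finset.prod_filter,
    Fin.prod_univ_castSucc, Fin.snoc_castSucc, Fin.snoc_last, Fin.castSucc_lt_castSucc_iff,
    Fin.castSucc_lt_last, if_true, hlast, lt_irrefl, if_false, Finset.prod_const_one, one_mul]
  congr 1
  exact Finset.sum_congr rfl fun i _ => by ring

theorem Bop_eigenvector (n : ℕ) (s : Fin n → Bool) :
    Bop n (eigenvector n s) = qint (weight s) • eigenvector n s := by
  induction n with
  | zero =>
    funext u
    simp [Bop_apply, weight, qint]
  | succ n ih =>
    induction s using Fin.snocCases with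
    | snoc s a =>
    funext u
    induction u using Fin.snocCases with
    | snoc u c =>
    have hB : Bop n (fun v => eigenvector n s v * letterCoeff (weight s) a c) u =
        letterCoeff (weight s) a c * (qint (weight s) * eigenvector n s u) := by
      have h : (fun v => eigenvector n s v * letterCoeff (weight s) a c) =
          letterCoeff (weight s) a c • eigenvector n s := by
        funext v
        simp [mul_comm]
      rw [h, map_smul, ih]
      simp
    simp only [Bop_snoc, eigenvector_snoc, weight_snoc, Pi.smul_apply, smul_eq_mul, hB]
    linear_combination eigenvector n s u * letterCoeff_eigen (weight s) a c

theorem eq_zero_of_sum_mul_letterCoeff_eq_zero (m : ℤ) (g : Bool → K)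
    (h : ∀ c, ∑ a, g a * letterCoeff m a c = 0) (a : Bool) : g a = 0 := by
  have h0 := h false
  have h1 := h true
  simp [letterCoeff, eps] at h0 h1
  have ht : g true = 0 := by
    have : g true * (q ^ m + q ^ (-m)) = 0 := by
      rw [zpow_neg]
      linear_combination h1 + (q ^ m)⁻¹ * h0
    exact (mul_eq_zero.1 this).resolve_right (q_zpow_add_zpow_neg_ne_zero m)
  cases a
  · linear_combination h0 - ht
  · exact ht

theorem linearIndependent_eigenvector (n : ℕ) : LinearIndependent K (eigenvector n) := by
  induction n with
  | zero =>
    rw [linearIndependent_unique_iff]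
    exact fun h => one_ne_zero (congrFun h default)
  | succ n ih =>
    rw [Fintype.linearIndependent_iff] at ih ⊢
    intro g hg s
    induction s using Fin.snocCases with
    | snoc s a =>
    refine eq_zero_of_sum_mul_letterCoeff_eq_zero (weight s)
      (fun a => g (Fin.snoc s a : Fin (n + 1) → Bool)) (fun c => ?_) a
    refine ih (fun s => ∑ a, g (Fin.snoc s a : Fin (n + 1) → Bool) *
      letterCoeff (weight s) a c) ?_ s
    funext u
    have hgu := congrFun hg (Fin.snoc u c : Fin (n + 1) → Bool)
    rw [← (Fin.snocEquiv fun _ => Bool).sum_comp, Fintype.sum_prod_type_right] at hgu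
    simp only [Finset.sum_apply, Pi.smul_apply, smul_eq_mul, Pi.zero_apply] at hgu ⊢
    rw [← hgu]
    refine Finset.sum_congr rfl fun s _ => ?_
    rw [Finset.sum_mul]
    refine Finset.sum_congr rfl fun a _ => ?_
    have hsnoc : (Fin.snocEquiv fun _ => Bool) (a, s) = (Fin.snoc s a : Fin (n + 1) → Bool) := rfl
    rw [hsnoc, eigenvector_snoc]
    ring

theorem finrank_centralizer_of_eigenbasis {F M ι : Type*} [Field F] [AddCommGroup M] [Module F M]
    [Fintype ι] [DecidableEq ι] [DecidableEq F] (b : Module.Basis ι F M) (d : ι → F)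
    (T : Module.End F M) (hT : ∀ i, T (b i) = d i • b i) :
    Module.finrank F (Subalgebra.centralizer F {T} : Subalgebra F (Module.End F M)) =
      Fintype.card {p : ι × ι // d p.1 = d p.2} := by
  have key : ∀ A : Module.End F M, A ∈ Subalgebra.centralizer F {T} ↔
      ∀ i j, d i ≠ d j → b.repr (A (b j)) i = 0 := by
    intro A
    have hrepr : ∀ x i, b.repr (T x) i = d i * b.repr x i := by
      intro x i
      have : (b.coord i).comp T = d i • b.coord i := by
        refine b.ext fun j => ?_
        by_cases h : j = i
        · subst h
          simp [hT]
        · simp [hT, h]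
      simpa using LinearMap.congr_fun this x
    have hcomm : A ∈ Subalgebra.centralizer F {T} ↔
        ∀ i j, d i * b.repr (A (b j)) i = d j * b.repr (A (b j)) i := by
      rw [Subalgebra.mem_centralizer_iff]
      constructor
      · intro h i j
        have := congrArg (fun x => b.repr x i) (LinearMap.congr_fun (h T rfl) (b j))
        simpa [hrepr, hT] using this
      · rintro h _ rfl
        refine b.ext fun j => b.ext_elem fun i => ?_
        simpa [hrepr, hT] using h i j
    rw [hcomm]
    refine forall₂_congr fun i j => ?_
    rw [mul_eq_mul_right_iff, ne_eq, or_iff_not_imp_left]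
  let Φ : (Subalgebra.centralizer F {T} : Subalgebra F (Module.End F M)) →ₗ[F]
      ({p : ι × ι // d p.1 = d p.2} → F) :=
    { toFun := fun A p => b.repr (A.1 (b p.1.2)) p.1.1
      map_add' := fun A A' => by
        funext p
        simp
      map_smul' := fun c A => by
        funext p
        simp }
  have hΦ : Function.Bijective Φ := by
    constructor
    · intro A A' h
      refine Subtype.ext (b.ext fun j => b.ext_elem fun i => ?_)
      by_cases hij : d i = d j
      · exact congrFun h ⟨(i, j), hij⟩
      · rw [(key A.1).1 A.2 i j hij, (key A'.1).1 A'.2 i j hij]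
    · intro f
      let A : Module.End F M := b.constr F fun j =>
        ∑ i, (if h : d i = d j then f ⟨(i, j), h⟩ else 0) • b i
      have hA : ∀ i j, b.repr (A (b j)) i = if h : d i = d j then f ⟨(i, j), h⟩ else 0 := by
        intro i j
        simp only [A, Module.Basis.constr_basis]
        rw [b.repr_sum_self]
      refine ⟨⟨A, (key A).2 fun i j hij => by rw [hA, dif_neg hij]⟩, ?_⟩
      funext p
      exact (hA _ _).trans (dif_pos p.2)
  rw [(LinearEquiv.ofBijective Φ hΦ).finrank_eq, Module.finrank_fintype_fun_eq_card]

theorem weight_eq {n : ℕ} (s : Fin n → Bool) :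
    weight s = 2 * (Finset.univ.filter fun i => s i = true).card - n := by
  have h : ∀ b : Bool, eps b = 2 * (if b = true then 1 else 0) - 1 := by decide
  simp only [weight, h, Finset.sum_sub_distrib, ← Finset.mul_sum, Finset.sum_boole]
  simp

theorem card_weight_eq_weight (n : ℕ) :
    Fintype.card {p : (Fin n → Bool) × (Fin n → Bool) // weight p.1 = weight p.2} =
      (2 * n).choose n := by
  have hcard : ((Finset.univ : Finset (Fin n ⊕ Fin n)).powersetCard n).card =
      (2 * n).choose n := by
    simp [two_mul]
  have hcompl : ∀ t : Fin n → Bool, (Finset.univ.filter fun i => t i = false).card +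
      (Finset.univ.filter fun i => t i = true).card = n := by
    intro t
    simpa using Finset.card_filter_add_card_filter_not (s := Finset.univ) (fun i => t i = false)
  have hsum : ∀ P : Fin n ⊕ Fin n → Prop, [DecidablePred P] →
      (Finset.univ.filter P).card = (Finset.univ.filter fun i => P (Sum.inl i)).card +
        (Finset.univ.filter fun i => P (Sum.inr i)).card := by
    intro P _
    simp only [Finset.card_filter, Fintype.sum_sum_type]
  rw [Fintype.card_subtype, ← hcard]
  refine Finset.card_nbij'
    (fun p => Finset.univ.filter fun x => Sum.elim p.1 (fun i => !p.2 i) x = true)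
    (fun S => (fun i => decide (Sum.inl i ∈ S), fun i => !decide (Sum.inr i ∈ S)))
    ?_ ?_ ?_ ?_
  · rintro ⟨s, t⟩ hst
    have hw : weight s = weight t := (Finset.mem_filter.1 hst).2
    rw [weight_eq, weight_eq] at hw
    have hw' : (Finset.univ.filter fun i => s i = true).card =
        (Finset.univ.filter fun i => t i = true).card := by omega
    have ht := hcompl t
    rw [← hw', add_comm] at ht
    refine Finset.mem_powersetCard.2 ⟨Finset.subset_univ _, ?_⟩
    rw [hsum]
    convert ht using 4 <;> simp
  · intro S hS
    have hS' : S.card = n := (Finset.mem_powersetCard.1 hS).2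
    have h1 := hsum (· ∈ S)
    rw [Finset.filter_univ_mem, hS'] at h1
    have h2 := hcompl fun i => !decide (Sum.inr i ∈ S)
    simp only [Finset.coe_filter, Finset.mem_univ, true_and, Set.mem_ofPred_eq, weight_eq]
    simp only [Bool.not_eq_eq_eq_not, Bool.not_true, Bool.not_false, decide_eq_true_eq,
      decide_eq_false_iff_not] at h2 ⊢
    omega
  · rintro ⟨s, t⟩ -
    ext i <;> simp
  · rintro S -
    ext (i | i) <;> simp

/-- For `n ≥ 1`, the centralizer of `B` in the endomorphism algebra of
`W n = V^{⊗n}` (i.e. the endomorphism algebra of `V^{⊗n}` over the coideal subalgebra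
`U_q'(gl₁ × gl₁)`) has `K`-dimension `(2n) choose n`. -/
theorem stmt_9 (n : ℕ) (hn : 1 ≤ n) :
    Module.finrank K (Subalgebra.centralizer K {Bop n} : Subalgebra K (Module.End K (W n))) =
      (2 * n).choose n := by
  classical
  have hcard : Fintype.card (Fin n → Bool) = Module.finrank K (W n) := by simp
  rw [finrank_centralizer_of_eigenbasis
    (basisOfLinearIndependentOfCardEqFinrank (linearIndependent_eigenvector n) hcard)
    (fun s => qint (weight s)) (Bop n) (fun s => by simp [Bop_eigenvector]),
    ← card_weight_eq_weight n]
  exact Fintype.card_congr (Equiv.subtypeEquivRight fun p => qint_injective.eq_iff)
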